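/- Let A be a nonzero m×n real matrix and θ > 0, and let X be a feasible solution of the problem: maximize ⟨A,X⟩ subject to ‖X‖_θ ≤ 1. Suppose there exist m×n matrices Y, Z and scalars α, β ≥ 0 such that: (i) Y + Z = A and ‖Y‖ = θ⁻¹‖Z‖_∞; (ii) X ∈ α·∂‖Y‖; (iii) X ∈ β·∂‖Z‖_∞; (iv) α + θβ = 1; and (v) the spectral norm is differentiable at Y or the entrywise max norm is differentiable at Z. Then X is the unique optimal solution of the problem. -/

import Mathlib

open scoped BigOperators Pointwise

noncomputable section

namespace LAROS

variable {m n : ℕ}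

/-- Trace inner product `⟨A,X⟩ = trace(Aᵀ X)`. -/
def mInner (A X : Matrix (Fin m) (Fin n) ℝ) : ℝ := ∑ i, ∑ j, A i j * X i j

/-- `N` is a norm on `m×n` real matrices. -/
def IsMatrixNorm (N : Matrix (Fin m) (Fin n) ℝ → ℝ) : Prop :=
  (∀ X, N X = 0 ↔ X = 0) ∧ (∀ (c : ℝ) (X), N (c • X) = |c| * N X) ∧
    (∀ X Y, N (X + Y) ≤ N X + N Y)

/-- Dual norm of `N`. -/
def dualNorm (N : Matrix (Fin m) (Fin n) ℝ → ℝ) (A : Matrix (Fin m) (Fin n) ℝ) : ℝ :=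
  sSup {r | ∃ Y, N Y ≤ 1 ∧ r = mInner A Y}

/-- `X` is optimal for: minimize `N X` subject to `⟨A,X⟩ ≥ 1`. -/
def IsOptMin (N : Matrix (Fin m) (Fin n) ℝ → ℝ) (A X : Matrix (Fin m) (Fin n) ℝ) : Prop :=
  1 ≤ mInner A X ∧ ∀ X', 1 ≤ mInner A X' → N X ≤ N X'

/-- `Y` is optimal for: maximize `⟨A,Y⟩` subject to `N Y ≤ 1`. -/
def IsOptMax (N : Matrix (Fin m) (Fin n) ℝ → ℝ) (A Y : Matrix (Fin m) (Fin n) ℝ) : Prop :=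
  N Y ≤ 1 ∧ ∀ Y', N Y' ≤ 1 → mInner A Y' ≤ mInner A Y

/-- Subdifferential of `f : ℝ^{m×n} → ℝ` at `A`, with respect to the trace inner product. -/
def subdiff (f : Matrix (Fin m) (Fin n) ℝ → ℝ) (A : Matrix (Fin m) (Fin n) ℝ) :
    Set (Matrix (Fin m) (Fin n) ℝ) :=
  {Y | ∀ B, f A + mInner (B - A) Y ≤ f B}

/-- The spectral norm (largest singular value) of an `m×n` real matrix. -/
def spectralNorm (A : Matrix (Fin m) (Fin n) ℝ) : ℝ :=
  sSup {r | ∃ (u : Fin m → ℝ) (v : Fin n → ℝ),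
    (∑ i, u i ^ 2) ≤ 1 ∧ (∑ j, v j ^ 2) ≤ 1 ∧ r = ∑ i, ∑ j, u i * A i j * v j}

/-- The nuclear norm (sum of singular values), as the dual norm of the spectral norm. -/
def nuclearNorm (A : Matrix (Fin m) (Fin n) ℝ) : ℝ := dualNorm spectralNorm A

/-- Entrywise ℓ1 norm: sum of absolute values of all entries. -/
def l1Norm (X : Matrix (Fin m) (Fin n) ℝ) : ℝ := ∑ i, ∑ j, |X i j|

/-- Entrywise max norm: maximum absolute value of an entry. -/
def maxNorm (X : Matrix (Fin m) (Fin n) ℝ) : ℝ := sSup {r | ∃ i j, r = |X i j|}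

/-- The norm `‖X‖_θ = ‖X‖_* + θ‖X‖₁`. -/
def thetaNorm (θ : ℝ) (X : Matrix (Fin m) (Fin n) ℝ) : ℝ := nuclearNorm X + θ * l1Norm X

attribute [local instance] Matrix.normedAddCommGroup Matrix.normedSpace

/-- The linear functional `B ↦ ⟨B, X⟩`. -/
def mInnerLin (X : Matrix (Fin m) (Fin n) ℝ) : Matrix (Fin m) (Fin n) ℝ →ₗ[ℝ] ℝ where
  toFun B := mInner B X
  map_add' B C := by simp [mInner, add_mul, Finset.sum_add_distrib]
  map_smul' c B := by simp [mInner, Finset.mul_sum, mul_assoc]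

theorem mInner_add_left (B C X : Matrix (Fin m) (Fin n) ℝ) :
    mInner (B + C) X = mInner B X + mInner C X := (mInnerLin X).map_add B C

theorem mInner_sub_left (B C X : Matrix (Fin m) (Fin n) ℝ) :
    mInner (B - C) X = mInner B X - mInner C X := (mInnerLin X).map_sub B C

theorem mInner_smul_left (c : ℝ) (B X : Matrix (Fin m) (Fin n) ℝ) :
    mInner (c • B) X = c * mInner B X := (mInnerLin X).map_smul c B

theorem mInner_comm (B X : Matrix (Fin m) (Fin n) ℝ) : mInner B X = mInner X B := by
  simp [mInner, mul_comm]

theorem mInner_smul_right (c : ℝ) (B X : Matrix (Fin m) (Fin n) ℝ) :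
    mInner B (c • X) = c * mInner B X := by
  rw [mInner_comm, mInner_smul_left, mInner_comm]

theorem mInner_single_one_left (i : Fin m) (j : Fin n) (X : Matrix (Fin m) (Fin n) ℝ) :
    mInner (Matrix.single i j 1) X = X i j := by
  simp only [mInner, Matrix.single_apply, ite_mul, one_mul, zero_mul, ite_and]
  simp

theorem mInner_le_of_abs_le {c : ℝ} {B : Matrix (Fin m) (Fin n) ℝ} (hB : ∀ i j, |B i j| ≤ c)
    (X : Matrix (Fin m) (Fin n) ℝ) : mInner B X ≤ c * l1Norm X := by
  simp only [mInner, l1Norm, Finset.mul_sum]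
  refine Finset.sum_le_sum fun i _ => Finset.sum_le_sum fun j _ => ?_
  calc B i j * X i j ≤ |B i j| * |X i j| := (le_abs_self _).trans (abs_mul _ _).le
    _ ≤ c * |X i j| := by gcongr; exact hB i j

theorem abs_le_one_of_sum_sq_le_one {k : ℕ} {u : Fin k → ℝ} (hu : ∑ i, u i ^ 2 ≤ 1) (i : Fin k) :
    |u i| ≤ 1 :=
  (sq_le_one_iff_abs_le_one _).1 <|
    (Finset.single_le_sum (f := fun i => u i ^ 2) (fun _ _ => sq_nonneg _)
      (Finset.mem_univ i)).trans hu

theorem bddAbove_spectralNorm (B : Matrix (Fin m) (Fin n) ℝ) :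
    BddAbove {r | ∃ (u : Fin m → ℝ) (v : Fin n → ℝ),
      (∑ i, u i ^ 2) ≤ 1 ∧ (∑ j, v j ^ 2) ≤ 1 ∧ r = ∑ i, ∑ j, u i * B i j * v j} := by
  refine ⟨l1Norm B, ?_⟩
  rintro r ⟨u, v, hu, hv, rfl⟩
  refine Finset.sum_le_sum fun i _ => Finset.sum_le_sum fun j _ => ?_
  calc u i * B i j * v j ≤ |u i| * |B i j| * |v j| := by
        rw [← abs_mul, ← abs_mul]; exact le_abs_self _
    _ ≤ 1 * |B i j| * 1 := by
        gcongr
        · exact abs_le_one_of_sum_sq_le_one hu i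
        · exact abs_le_one_of_sum_sq_le_one hv j
    _ = |B i j| := by ring

theorem abs_apply_le_spectralNorm (B : Matrix (Fin m) (Fin n) ℝ) (i : Fin m) (j : Fin n) :
    |B i j| ≤ spectralNorm B := by
  have key : ∀ s : ℝ, s ^ 2 ≤ 1 → s * B i j ≤ spectralNorm B := fun s hs =>
    le_csSup (bddAbove_spectralNorm B)
      ⟨Pi.single i s, Pi.single j 1, by simpa [Pi.single_apply, ite_pow] using hs,
        by simp [Pi.single_apply, ite_pow], by simp [Pi.single_apply]⟩
  refine abs_le'.2 ⟨?_, ?_⟩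
  · simpa using key 1 (by norm_num)
  · simpa using key (-1) (by norm_num)

theorem spectralNorm_nonneg (B : Matrix (Fin m) (Fin n) ℝ) : 0 ≤ spectralNorm B :=
  le_csSup (bddAbove_spectralNorm B) ⟨0, 0, by simp, by simp, by simp⟩

theorem spectralNorm_smul_of_nonneg {c : ℝ} (hc : 0 ≤ c) (B : Matrix (Fin m) (Fin n) ℝ) :
    spectralNorm (c • B) = c * spectralNorm B := by
  rw [spectralNorm, spectralNorm, ← smul_eq_mul, ← Real.sSup_smul_of_nonneg hc]
  congr 1
  have scale : ∀ (u : Fin m → ℝ) (v : Fin n → ℝ),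
      ∑ i, ∑ j, u i * (c • B) i j * v j = c • ∑ i, ∑ j, u i * B i j * v j := fun u v => by
    simp only [Matrix.smul_apply, smul_eq_mul, Finset.mul_sum]
    refine Finset.sum_congr rfl fun i _ => Finset.sum_congr rfl fun j _ => by ring
  ext r
  constructor
  · rintro ⟨u, v, hu, hv, rfl⟩
    exact ⟨_, ⟨u, v, hu, hv, rfl⟩, (scale u v).symm⟩
  · rintro ⟨_, ⟨u, v, hu, hv, rfl⟩, rfl⟩
    exact ⟨u, v, hu, hv, (scale u v).symm⟩

theorem abs_apply_le_maxNorm (B : Matrix (Fin m) (Fin n) ℝ) (i : Fin m) (j : Fin n) :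
    |B i j| ≤ maxNorm B := by
  refine le_csSup ⟨l1Norm B, ?_⟩ ⟨i, j, rfl⟩
  rintro r ⟨i, j, rfl⟩
  calc |B i j| ≤ ∑ j, |B i j| :=
        Finset.single_le_sum (f := fun j => |B i j|) (fun _ _ => abs_nonneg _) (Finset.mem_univ j)
    _ ≤ l1Norm B :=
        Finset.single_le_sum (f := fun i => ∑ j, |B i j|)
          (fun _ _ => Finset.sum_nonneg fun _ _ => abs_nonneg _) (Finset.mem_univ i)

theorem maxNorm_smul_of_nonneg {c : ℝ} (hc : 0 ≤ c) (B : Matrix (Fin m) (Fin n) ℝ) :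
    maxNorm (c • B) = c * maxNorm B := by
  rw [maxNorm, maxNorm, ← smul_eq_mul, ← Real.sSup_smul_of_nonneg hc]
  congr 1
  have scale : ∀ i j, |(c • B) i j| = c • |B i j| := fun i j => by
    simp [abs_mul, abs_of_nonneg hc]
  ext r
  constructor
  · rintro ⟨i, j, rfl⟩
    exact ⟨_, ⟨i, j, rfl⟩, (scale i j).symm⟩
  · rintro ⟨_, ⟨i, j, rfl⟩, rfl⟩
    exact ⟨i, j, (scale i j).symm⟩

theorem mInner_le_spectralNorm_mul_nuclearNorm (B X : Matrix (Fin m) (Fin n) ℝ) :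
    mInner B X ≤ spectralNorm B * nuclearNorm X := by
  have bdd : BddAbove {r | ∃ W, spectralNorm W ≤ 1 ∧ r = mInner X W} := by
    refine ⟨1 * l1Norm X, ?_⟩
    rintro r ⟨W, hW, rfl⟩
    rw [mInner_comm]
    exact mInner_le_of_abs_le (fun i j => (abs_apply_le_spectralNorm W i j).trans hW) X
  rcases (spectralNorm_nonneg B).eq_or_lt with h0 | hpos
  · have := mInner_le_of_abs_le (fun i j => abs_apply_le_spectralNorm B i j) X
    rw [← h0] at this ⊢
    simpa using this
  · have hle : mInner X ((spectralNorm B)⁻¹ • B) ≤ nuclearNorm X := by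
      refine le_csSup bdd ⟨_, ?_, rfl⟩
      rw [spectralNorm_smul_of_nonneg (inv_nonneg.2 hpos.le), inv_mul_cancel₀ hpos.ne']
    rw [mInner_smul_right, mInner_comm, inv_mul_le_iff₀ hpos] at hle
    exact hle

/-- `X` is `c` times a subgradient at `Y` of a positively homogeneous function `f`, in the form
that also makes sense for `c = 0`. -/
def IsScaledSubgradient (f : Matrix (Fin m) (Fin n) ℝ → ℝ) (Y : Matrix (Fin m) (Fin n) ℝ) (c : ℝ)
    (X : Matrix (Fin m) (Fin n) ℝ) : Prop :=
  (∀ B, mInner B X ≤ c * f B) ∧ mInner Y X = c * f Y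

theorem isScaledSubgradient_of_mem_smul_subdiff {f : Matrix (Fin m) (Fin n) ℝ → ℝ}
    (hf : ∀ c : ℝ, 0 ≤ c → ∀ B, f (c • B) = c * f B) {Y X : Matrix (Fin m) (Fin n) ℝ} {c : ℝ}
    (hc : 0 ≤ c) (hX : X ∈ c • subdiff f Y) : IsScaledSubgradient f Y c X := by
  obtain ⟨G, hG, rfl⟩ := hX
  have hzero : f 0 = 0 := by simpa using hf 0 le_rfl 0
  have hlow := hG 0
  have hupp := hG ((2 : ℝ) • Y)
  rw [hf 2 zero_le_two, mInner_sub_left, mInner_smul_left] at hupp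
  rw [mInner_sub_left, hzero, ← zero_smul ℝ Y, mInner_smul_left] at hlow
  have hY : mInner Y G = f Y := by linarith
  refine ⟨fun B => ?_, ?_⟩
  · have hB := hG B
    rw [mInner_sub_left] at hB
    simp only [mInner_smul_right]
    exact mul_le_mul_of_nonneg_left (by linarith) hc
  · simp only [mInner_smul_right, hY]

theorem IsScaledSubgradient.mInner_eq_fderiv {f : Matrix (Fin m) (Fin n) ℝ → ℝ}
    {Y X : Matrix (Fin m) (Fin n) ℝ} {c : ℝ} (hX : IsScaledSubgradient f Y c X)
    (hf : DifferentiableAt ℝ f Y) (B : Matrix (Fin m) (Fin n) ℝ) :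
    mInner B X = c * fderiv ℝ f Y B := by
  have hmin : IsLocalMin (fun B => c * f B - LinearMap.toContinuousLinearMap (mInnerLin X) B) Y :=
    Filter.Eventually.of_forall fun C => by
      have h₁ := hX.1 C
      have h₂ := hX.2
      change c * f Y - mInner Y X ≤ c * f C - mInner C X
      linarith
  have hzero := hmin.hasFDerivAt_eq_zero
    ((hf.hasFDerivAt.const_mul c).sub (LinearMap.toContinuousLinearMap (mInnerLin X)).hasFDerivAt)
  have hB := congrArg (fun L => L B) hzero
  change c * fderiv ℝ f Y B - mInner B X = 0 at hB
  linarith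

theorem IsScaledSubgradient.eq_of_differentiableAt {f : Matrix (Fin m) (Fin n) ℝ → ℝ}
    {A Y X X' : Matrix (Fin m) (Fin n) ℝ} {c c' : ℝ} (hX : IsScaledSubgradient f Y c X)
    (hX' : IsScaledSubgradient f Y c' X') (hf : DifferentiableAt ℝ f Y)
    (hA : mInner A X' = mInner A X) (hA₀ : mInner A X ≠ 0) : X' = X := by
  have hc : c' = c := by
    have hAX := hX.mInner_eq_fderiv hf A
    rw [hX'.mInner_eq_fderiv hf, hAX] at hA
    exact mul_right_cancel₀ (fun h => hA₀ (by rw [hAX, h, mul_zero])) hA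
  ext i j
  rw [← mInner_single_one_left i j X', ← mInner_single_one_left i j X,
    hX.mInner_eq_fderiv hf, hX'.mInner_eq_fderiv hf, hc]

theorem stmt10 (θ : ℝ) (hθ : 0 < θ) (A : Matrix (Fin m) (Fin n) ℝ) (hA : A ≠ 0)
    (X Y Z : Matrix (Fin m) (Fin n) ℝ) (α β : ℝ)
    (hXfeas : thetaNorm θ X ≤ 1)
    (hYZ : Y + Z = A) (hbal : spectralNorm Y = θ⁻¹ * maxNorm Z)
    (hα : 0 ≤ α) (hβ : 0 ≤ β)
    (hXY : X ∈ α • subdiff spectralNorm Y)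
    (hXZ : X ∈ β • subdiff maxNorm Z)
    (hαβ : α + θ * β = 1)
    (hdiff : DifferentiableAt ℝ (spectralNorm (m := m) (n := n)) Y ∨
      DifferentiableAt ℝ (maxNorm (m := m) (n := n)) Z) :
    IsOptMax (thetaNorm θ) A X ∧
      ∀ X', IsOptMax (thetaNorm θ) A X' → X' = X := by
  set σ := spectralNorm Y with hσ
  have hmax : maxNorm Z = θ * σ := by rw [hbal]; field_simp
  have hσpos : 0 < σ := by
    refine (spectralNorm_nonneg Y).lt_of_ne' fun h0 => hA ?_
    ext i j
    have hYij := abs_apply_le_spectralNorm Y i j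
    have hZij := abs_apply_le_maxNorm Z i j
    rw [h0] at hYij
    rw [hmax, hσ, h0, mul_zero] at hZij
    simp [← hYZ, abs_nonpos_iff.1 hYij, abs_nonpos_iff.1 hZij]
  have hnuc : ∀ W B : Matrix (Fin m) (Fin n) ℝ,
      mInner B W ≤ nuclearNorm W * spectralNorm B := fun W B => by
    rw [mul_comm]; exact mInner_le_spectralNorm_mul_nuclearNorm B W
  have hl1 : ∀ W B : Matrix (Fin m) (Fin n) ℝ, mInner B W ≤ l1Norm W * maxNorm B := fun W B => by
    rw [mul_comm]; exact mInner_le_of_abs_le (abs_apply_le_maxNorm B) W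
  have hsplit : ∀ W, mInner A W = mInner Y W + mInner Z W := fun W => by
    rw [← hYZ, mInner_add_left]
  have hbound : ∀ W : Matrix (Fin m) (Fin n) ℝ, thetaNorm θ W ≤ 1 →
      nuclearNorm W * σ + l1Norm W * maxNorm Z ≤ σ := fun W hW => by
    have := mul_le_mul_of_nonneg_right hW hσpos.le
    rw [thetaNorm] at this
    rw [hmax]
    linarith
  have hsubY := isScaledSubgradient_of_mem_smul_subdiff
    (fun _ hc B => spectralNorm_smul_of_nonneg hc B) hα hXY
  have hsubZ := isScaledSubgradient_of_mem_smul_subdiff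
    (fun _ hc B => maxNorm_smul_of_nonneg hc B) hβ hXZ
  have hval : mInner A X = σ := by
    rw [hsplit, hsubY.2, hsubZ.2, hmax, ← hσ]
    linear_combination σ * hαβ
  have hopt : IsOptMax (thetaNorm θ) A X := by
    refine ⟨hXfeas, fun W hW => ?_⟩
    rw [hval, hsplit]
    linarith [hnuc W Y, hl1 W Z, hbound W hW]
  refine ⟨hopt, fun X' hX' => ?_⟩
  have hval' : mInner A X' = mInner A X := (hopt.2 X' hX'.1).antisymm (hX'.2 X hXfeas)
  have hsum := (hsplit X').symm.trans (hval'.trans hval)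
  have hA₀ : mInner A X ≠ 0 := hval ▸ hσpos.ne'
  have hY := hnuc X' Y
  have hZ := hl1 X' Z
  have hX'bound := hbound X' hX'.1
  rcases hdiff with hd | hd
  · exact hsubY.eq_of_differentiableAt ⟨hnuc X', by linarith⟩ hd hval' hA₀
  · exact hsubZ.eq_of_differentiableAt ⟨hl1 X', by linarith⟩ hd hval' hA₀

end LAROS
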